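/- The ordered configuration space Conf(K,2) of two points on the Y-graph K is path-connected. In particular, for every pair of distinct points x, y ∈ K there is a continuous path in Conf(K,2) from the configuration (x,y) to the exchanged configuration (y,x). (This expresses that the first Stiefel–Whitney class of the canonical bundle ξ_{K,2} is nonzero, i.e. the double cover Conf(K,2) → UConf(K,2) is connected.) -/

import Mathlib

/-- The ordered configuration space of `n` points in `X`:
the subspace `{f : Fin n → X | f injective}` of the product `X ^ (Fin n)`. -/
abbrev Conf (X : Type*) [TopologicalSpace X] (n : ℕ) : Type _ :=
  {f : Fin n → X // Function.Injective f}

/-- The symmetric group `Σ_n = Equiv.Perm (Fin n)` acts on `Conf X n` by `σ • f = f ∘ σ⁻¹`. -/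
instance confMulAction (X : Type*) [TopologicalSpace X] (n : ℕ) :
    MulAction (Equiv.Perm (Fin n)) (Conf X n) where
  smul σ f := ⟨f.1 ∘ ⇑σ⁻¹, f.2.comp (Equiv.injective _)⟩
  one_smul _ := Subtype.ext rfl
  mul_smul _ _ _ := Subtype.ext rfl

/-- The unordered configuration space `UConf X n = Conf(X,n)/Σ_n`, with the quotient topology. -/
abbrev UConf (X : Type*) [TopologicalSpace X] (n : ℕ) : Type _ :=
  Quotient (MulAction.orbitRel (Equiv.Perm (Fin n)) (Conf X n))

/-- The Y-graph: the union in `ℂ` of the three segments from the origin to the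
third roots of unity. -/
def Ygraph : Set ℂ :=
  ⋃ k : Fin 3, {z : ℂ | ∃ t : ℝ, t ∈ Set.Icc (0 : ℝ) 1 ∧
    z = (t : ℂ) * Complex.exp (2 * Real.pi * Complex.I * ((k : ℕ) : ℂ) / 3)}

/-- The point at distance `t` from the centre on the `k`-th leg of the Y-graph. -/
noncomputable def legPoint (k : Fin 3) (t : ℝ) : ℂ :=
  (t : ℂ) * Complex.exp (2 * Real.pi * Complex.I * ((k : ℕ) : ℂ) / 3)

lemma mem_Ygraph_iff {z : ℂ} :
    z ∈ Ygraph ↔ ∃ k : Fin 3, ∃ t ∈ Set.Icc (0 : ℝ) 1, z = legPoint k t := by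
  simp only [Ygraph, Set.mem_iUnion, Set.mem_ofPred_eq, legPoint]

lemma legPoint_mem (k : Fin 3) {t : ℝ} (ht : t ∈ Set.Icc (0 : ℝ) 1) : legPoint k t ∈ Ygraph :=
  mem_Ygraph_iff.2 ⟨k, t, ht, rfl⟩

@[simp] lemma legPoint_zero (k : Fin 3) : legPoint k 0 = 0 := by simp [legPoint]

lemma continuous_legPoint (k : Fin 3) : Continuous (legPoint k) := by
  unfold legPoint; fun_prop

lemma norm_legPoint (k : Fin 3) {t : ℝ} (ht : 0 ≤ t) : ‖legPoint k t‖ = t := by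
  have h : 2 * (Real.pi : ℂ) * Complex.I * ((k : ℕ) : ℂ) / 3
      = ((2 * Real.pi * (k : ℕ) / 3 : ℝ) : ℂ) * Complex.I := by
    push_cast; ring
  rw [legPoint, h, norm_mul, Complex.norm_exp_ofReal_mul_I, mul_one, Complex.norm_real,
    Real.norm_of_nonneg ht]

lemma legPoint_eq {i j : Fin 3} {s t : ℝ} (hs : 0 ≤ s) (ht : 0 ≤ t)
    (h : legPoint i s = legPoint j t) : s = t ∧ (s = 0 ∨ i = j) := by
  have hst : s = t := by rw [← norm_legPoint i hs, h, norm_legPoint j ht]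
  refine ⟨hst, or_iff_not_imp_left.2 fun h0 => ?_⟩
  subst hst
  have h' := mul_left_cancel₀ (Complex.ofReal_ne_zero.2 h0) h
  obtain ⟨n, hn⟩ := Complex.exp_eq_exp_iff_exists_int.1 h'
  have hc : (2 * Real.pi * Complex.I : ℂ) ≠ 0 := Complex.two_pi_I_ne_zero
  have hz : (((i : ℕ) : ℤ) : ℂ) = (((j : ℕ) + 3 * n : ℤ) : ℂ) := by
    apply mul_left_cancel₀ hc
    push_cast
    linear_combination 3 * hn
  have := Int.cast_injective hz
  omega

/-- The ordered pairs of distinct points of the Y-graph. -/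
def distinctPairs : Set (ℂ × ℂ) := {p | p.1 ∈ Ygraph ∧ p.2 ∈ Ygraph ∧ p.1 ≠ p.2}

lemma joinedIn_of_segment {i j : Fin 3} {s₀ s₁ t₀ t₁ : ℝ}
    (hs₀ : s₀ ∈ Set.Icc (0 : ℝ) 1) (hs₁ : s₁ ∈ Set.Icc (0 : ℝ) 1)
    (ht₀ : t₀ ∈ Set.Icc (0 : ℝ) 1) (ht₁ : t₁ ∈ Set.Icc (0 : ℝ) 1)
    (h : ∀ r ∈ Set.Icc (0 : ℝ) 1, legPoint i (AffineMap.lineMap s₀ s₁ r)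
      ≠ legPoint j (AffineMap.lineMap t₀ t₁ r)) :
    JoinedIn distinctPairs (legPoint i s₀, legPoint j t₀) (legPoint i s₁, legPoint j t₁) := by
  refine JoinedIn.ofLine (f := fun r : ℝ => (legPoint i (AffineMap.lineMap s₀ s₁ r),
    legPoint j (AffineMap.lineMap t₀ t₁ r))) ?_ (by simp) (by simp) ?_
  · exact (((continuous_legPoint i).comp AffineMap.lineMap_continuous).prodMk
      ((continuous_legPoint j).comp AffineMap.lineMap_continuous)).continuousOn
  · rintro _ ⟨r, hr, rfl⟩
    exact ⟨legPoint_mem i ((convex_Icc (0 : ℝ) 1).lineMap_mem hs₀ hs₁ hr),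
      legPoint_mem j ((convex_Icc (0 : ℝ) 1).lineMap_mem ht₀ ht₁ hr), h r hr⟩

lemma joinedIn_of_ne {i j : Fin 3} (hij : i ≠ j) {s₀ s₁ t₀ t₁ : ℝ}
    (hs₀ : s₀ ∈ Set.Icc (0 : ℝ) 1) (hs₁ : s₁ ∈ Set.Icc (0 : ℝ) 1)
    (ht₀ : t₀ ∈ Set.Icc (0 : ℝ) 1) (ht₁ : t₁ ∈ Set.Icc (0 : ℝ) 1)
    (h₀ : 0 < s₀ + t₀) (h₁ : 0 < s₁ + t₁) :
    JoinedIn distinctPairs (legPoint i s₀, legPoint j t₀) (legPoint i s₁, legPoint j t₁) := by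
  refine joinedIn_of_segment hs₀ hs₁ ht₀ ht₁ fun r hr he => ?_
  obtain ⟨h, h' | h'⟩ := legPoint_eq ((convex_Icc (0 : ℝ) 1).lineMap_mem hs₀ hs₁ hr).1
    ((convex_Icc (0 : ℝ) 1).lineMap_mem ht₀ ht₁ hr).1 he
  · have := (convex_Ioi (0 : ℝ)).lineMap_mem h₀ h₁ hr
    rw [Set.mem_Ioi, AffineMap.lineMap_apply_ring] at this
    rw [h'] at h
    rw [AffineMap.lineMap_apply_ring] at h h'
    linarith
  · exact hij h'

lemma joinedIn_of_same_leg (i : Fin 3) {s₀ s₁ t₀ t₁ : ℝ}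
    (hs₀ : s₀ ∈ Set.Icc (0 : ℝ) 1) (hs₁ : s₁ ∈ Set.Icc (0 : ℝ) 1)
    (ht₀ : t₀ ∈ Set.Icc (0 : ℝ) 1) (ht₁ : t₁ ∈ Set.Icc (0 : ℝ) 1)
    (h : 0 < (t₀ - s₀) * (t₁ - s₁)) :
    JoinedIn distinctPairs (legPoint i s₀, legPoint i t₀) (legPoint i s₁, legPoint i t₁) := by
  refine joinedIn_of_segment hs₀ hs₁ ht₀ ht₁ fun r hr he => ?_
  have he' := (legPoint_eq ((convex_Icc (0 : ℝ) 1).lineMap_mem hs₀ hs₁ hr).1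
    ((convex_Icc (0 : ℝ) 1).lineMap_mem ht₀ ht₁ hr).1 he).1
  rw [AffineMap.lineMap_apply_ring, AffineMap.lineMap_apply_ring] at he'
  rcases mul_pos_iff.1 h with ⟨h₀, h₁⟩ | ⟨h₀, h₁⟩
  · have := (convex_Ioi (0 : ℝ)).lineMap_mem h₀ h₁ hr
    rw [Set.mem_Ioi, AffineMap.lineMap_apply_ring] at this
    linarith
  · have := (convex_Iio (0 : ℝ)).lineMap_mem h₀ h₁ hr
    rw [Set.mem_Iio, AffineMap.lineMap_apply_ring] at this
    linarith

lemma joinedIn_end_centre {i j : Fin 3} (hij : i ≠ j) :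
    JoinedIn distinctPairs (legPoint i 1, 0) (0, legPoint j 1) := by
  have := joinedIn_of_ne hij (s₀ := 1) (s₁ := 0) (t₀ := 0) (t₁ := 1)
    (by simp) (by simp) (by simp) (by simp) (by simp) (by simp)
  rwa [legPoint_zero, legPoint_zero] at this

lemma joinedIn_centre_end (j : Fin 3) :
    JoinedIn distinctPairs (0, legPoint j 1) (legPoint 0 1, 0) := by
  have h₁ : JoinedIn distinctPairs (0, legPoint 1 1) (legPoint 0 1, 0) :=
    (joinedIn_end_centre (by decide)).symm
  have h₂ : JoinedIn distinctPairs (0, legPoint 2 1) (legPoint 0 1, 0) :=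
    (joinedIn_end_centre (by decide)).symm
  fin_cases j
  · exact ((joinedIn_end_centre (i := 2) (by decide)).symm.trans
      (joinedIn_end_centre (by decide))).trans h₁
  · exact h₁
  · exact h₂

lemma joinedIn_end_end (i : Fin 3) :
    JoinedIn distinctPairs (legPoint i 1, 0) (legPoint 0 1, 0) := by
  obtain ⟨j, hj⟩ := exists_ne i
  exact (joinedIn_end_centre hj.symm).trans (joinedIn_centre_end j)

lemma isPathConnected_distinctPairs : IsPathConnected distinctPairs := by
  refine ⟨(legPoint 0 1, 0), (joinedIn_end_end 0).source_mem, ?_⟩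
  rintro ⟨x, y⟩ ⟨hx, hy, hxy⟩
  refine JoinedIn.symm ?_
  obtain ⟨i, s, hs, rfl⟩ := mem_Ygraph_iff.1 hx
  obtain ⟨j, t, ht, rfl⟩ := mem_Ygraph_iff.1 hy
  have h0 : (0 : ℝ) ∈ Set.Icc (0 : ℝ) 1 := by simp
  have h1 : (1 : ℝ) ∈ Set.Icc (0 : ℝ) 1 := by simp
  by_cases hij : i = j
  · subst hij
    rcases lt_trichotomy s t with h | rfl | h
    · have := joinedIn_of_same_leg i hs h0 ht h1 (by linarith)
      rw [legPoint_zero] at this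
      exact this.trans (joinedIn_centre_end i)
    · exact absurd rfl hxy
    · have := joinedIn_of_same_leg i hs h1 ht h0 (by linarith)
      rw [legPoint_zero] at this
      exact this.trans (joinedIn_end_end i)
  · have hpos : 0 < s + t := by
      refine (add_nonneg hs.1 ht.1).lt_of_ne fun h => hxy ?_
      have hs0 : s = 0 := by linarith [hs.1, ht.1]
      have ht0 : t = 0 := by linarith [hs.1, ht.1]
      simp [hs0, ht0]
    have := joinedIn_of_ne hij hs h1 ht h0 hpos (by simp)
    rw [legPoint_zero] at this
    exact this.trans (joinedIn_end_end i)

/-- The configuration given by an ordered pair of distinct points of the Y-graph. -/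
def confOfPair (p : distinctPairs) : Conf ↥Ygraph 2 :=
  ⟨![⟨p.1.1, p.2.1⟩, ⟨p.1.2, p.2.2.1⟩],
    injective_pair_iff_ne.2 fun h => p.2.2.2 (congrArg Subtype.val h)⟩

lemma continuous_confOfPair : Continuous confOfPair := by
  refine Continuous.subtype_mk (continuous_pi fun k => ?_) _
  fin_cases k
  · exact (continuous_fst.comp continuous_subtype_val).subtype_mk _
  · exact (continuous_snd.comp continuous_subtype_val).subtype_mk _

lemma confOfPair_surjective : Function.Surjective confOfPair := by
  intro f
  refine ⟨⟨(f.1 0, f.1 1), (f.1 0).2, (f.1 1).2,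
    fun h => absurd (f.2 (Subtype.ext h)) (by decide)⟩, Subtype.ext ?_⟩
  funext k
  fin_cases k <;> rfl

/-- The ordered configuration space of two points on the Y-graph is path-connected;
in particular any configuration can be continuously exchanged with its transpose. -/
theorem stmt12 :
    PathConnectedSpace (Conf ↥Ygraph 2) ∧
    ∀ x y : ↥Ygraph, x ≠ y →
      ∃ γ : unitInterval → Conf ↥Ygraph 2, Continuous γ ∧
        (γ 0).1 = ![x, y] ∧ (γ 1).1 = ![y, x] := by
  have : PathConnectedSpace distinctPairs :=
    isPathConnected_iff_pathConnectedSpace.1 isPathConnected_distinctPairs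
  have hconf : PathConnectedSpace (Conf ↥Ygraph 2) :=
    confOfPair_surjective.pathConnectedSpace continuous_confOfPair
  refine ⟨hconf, fun x y hxy => ?_⟩
  let γ := PathConnectedSpace.somePath
    (confOfPair ⟨(x, y), x.2, y.2, fun h => hxy (Subtype.ext h)⟩)
    (confOfPair ⟨(y, x), y.2, x.2, fun h => hxy (Subtype.ext h.symm)⟩)
  exact ⟨γ, γ.continuous, congrArg Subtype.val γ.source, congrArg Subtype.val γ.target⟩
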